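/- arXiv:1312.1674 — 5 statements merged into one kernel-verified Lean document; each statement's English description precedes it below -/
import Mathlib

section
/- Let n ≥ 2 and let G be a finite abelian group which is the internal direct sum of cyclic subgroups generated by elements e_1, …, e_n, where d_i denotes the order of e_i and d_i divides d_{i+1} for 1 ≤ i < n. Let φ : G → C be a surjective group homomorphism onto a finite cyclic group C of order N, and let B be a positive integer such that gcd(d_{n-1}, N) is B-smooth. Then there exists a B-smooth positive integer s dividing N such that N/s divides the order of φ(e_n) in C. -/
/-- A positive integer is `B`-smooth if every prime dividing it is at most `B`. -/
def IsSmooth (B s : ℕ) : Prop := ∀ p : ℕ, p.Prime → p ∣ s → p ≤ B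

/-- If a finite cyclic group of order `N` is a homomorphic image of a commutative group generated
by a family `e`, then `N` divides any exponent killing the images of all the `e i`. -/
theorem card_dvd_of_forall_pow_eq_one {G C ι : Type*} [CommGroup G] [CommGroup C] [Fintype C]
    [IsCyclic C] [Fintype ι] (e : ι → G) (hgen : ∀ g : G, ∃ c : ι → ℤ, g = ∏ i, e i ^ c i)
    (φ : G →* C) (hφ : Function.Surjective φ) (k : ℕ) (hk : ∀ i, φ (e i) ^ k = 1) :
    Fintype.card C ∣ k := by
  obtain ⟨y, hy⟩ := IsCyclic.exists_generator (α := C)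
  rw [← Nat.card_eq_fintype_card, ← orderOf_eq_card_of_forall_mem_zpowers hy,
    orderOf_dvd_iff_pow_eq_one]
  obtain ⟨x, rfl⟩ := hφ y
  obtain ⟨c, rfl⟩ := hgen x
  rw [map_prod, ← Finset.prod_pow]
  refine Finset.prod_eq_one fun i _ => ?_
  rw [map_zpow, ← zpow_natCast, zpow_comm, zpow_natCast, hk, one_zpow]

/-- In a finite sequence where each term divides the next, each term divides all later ones. -/
theorem dvd_of_le_of_forall_dvd_succ {n : ℕ} (d : Fin n → ℕ)
    (hdiv : ∀ i j : Fin n, (i : ℕ) + 1 = j → d i ∣ d j) {i j : Fin n} (hij : i ≤ j) :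
    d i ∣ d j := by
  obtain ⟨i, hi⟩ := i
  obtain ⟨j, hj⟩ := j
  replace hij : i ≤ j := hij
  induction j, hij using Nat.le_induction with
  | base => exact dvd_rfl
  | succ j hij ih => exact (ih (by omega)).trans (hdiv _ _ rfl)

/-- Let `n ≥ 2` and let `G` be a finite abelian group which is the internal direct sum of
cyclic subgroups generated by `e 0, …, e (n-1)` (so every element of `G` is uniquely a
product of powers of the `e i`), where `d i` is the order of `e i` and `d i ∣ d (i+1)`.
Let `φ : G → C` be a surjective homomorphism onto a finite cyclic group `C` of order `N`,
and let `B > 0` be such that `gcd(d (n-2), N)` is `B`-smooth.  Then there is a `B`-smooth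
positive integer `s` dividing `N` such that `N / s` divides the order of `φ (e (n-1))`. -/
theorem stmt0 {G : Type*} [CommGroup G] [Fintype G] {C : Type*} [CommGroup C] [Fintype C]
    [IsCyclic C] (n : ℕ) (hn : 2 ≤ n) (e : Fin n → G) (d : Fin n → ℕ)
    (hd : ∀ i, d i = orderOf (e i))
    (hdiv : ∀ (i : ℕ) (hi : i + 1 < n), d ⟨i, by omega⟩ ∣ d ⟨i + 1, hi⟩)
    (hgen : ∀ g : G, ∃ c : Fin n → ℤ, g = ∏ i, e i ^ c i)
    (huniq : ∀ c c' : Fin n → ℤ, ∏ i, e i ^ c i = ∏ i, e i ^ c' i →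
      ∀ i, (d i : ℤ) ∣ c i - c' i)
    (N : ℕ) (hN : Fintype.card C = N) (φ : G →* C) (hφ : Function.Surjective φ)
    (B : ℕ) (hB : 0 < B)
    (hsm : IsSmooth B (Nat.gcd (d ⟨n - 2, by omega⟩) N)) :
    ∃ s : ℕ, 0 < s ∧ s ∣ N ∧ IsSmooth B s ∧ (N / s) ∣ orderOf (φ (e ⟨n - 1, by omega⟩)) := by
  have hmN : orderOf (φ (e ⟨n - 1, by omega⟩)) ∣ N := hN ▸ orderOf_dvd_card
  set m := orderOf (φ (e ⟨n - 1, by omega⟩))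
  set g := Nat.gcd (d ⟨n - 2, by omega⟩) N
  have hNpos : 0 < N := hN ▸ Fintype.card_pos
  have hmpos : 0 < m := Nat.pos_of_dvd_of_pos hmN hNpos
  have hdvd : N ∣ m * g := by
    rw [← hN]
    refine card_dvd_of_forall_pow_eq_one e hgen φ hφ _ fun i => ?_
    rw [← orderOf_dvd_iff_pow_eq_one]
    obtain ⟨i, hi⟩ := i
    rcases Nat.lt_or_ge i (n - 1) with h | h
    · refine Dvd.dvd.mul_left (Nat.dvd_gcd ?_ (hN ▸ orderOf_dvd_card)) m
      refine (orderOf_map_dvd φ _).trans ?_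
      rw [← hd]
      refine dvd_of_le_of_forall_dvd_succ d ?_ (Fin.mk_le_mk.2 (by omega))
      rintro ⟨a, ha⟩ ⟨b, hb⟩ rfl
      exact hdiv a hb
    · obtain rfl : i = n - 1 := by omega
      exact Dvd.intro _ rfl
  refine ⟨N / m, Nat.div_pos (Nat.le_of_dvd hNpos hmN) hmpos, Nat.div_dvd_of_dvd hmN,
    fun p hp hpd => hsm p hp (hpd.trans ((Nat.div_dvd_iff_dvd_mul hmN hmpos).2 hdvd)), ?_⟩
  rw [Nat.div_div_self hmN hNpos.ne']
end

section
/- Let K be a finite field of order Q and let h = g·k in K[x], where g is irreducible of degree m and g does not divide k (so g² does not divide h). Let B be a positive integer such that gcd(|(K[x]/(k))ˣ|, Q^m − 1) is B-smooth. Let D be a finite set of polynomials in K[x], each coprime to h, whose reductions modulo g generate the unit group (K[x]/(g))ˣ, and let G be the subgroup of (K[x]/(h))ˣ generated by the reductions of the elements of D modulo h. If G is the internal direct sum of cyclic subgroups generated by elements e_1, …, e_n with orders d_1 ∣ d_2 ∣ … ∣ d_n, then gcd(d_{n-1}, Q^m − 1) is B-smooth. -/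
open Polynomial in
theorem Polynomial.finite_quotient_span_singleton {K : Type*} [Field K] [Finite K] {h : K[X]}
    (hh : h ≠ 0) : Finite (K[X] ⧸ Ideal.span {h}) := by
  have : Module.Finite K (AdjoinRoot h) := (AdjoinRoot.powerBasis hh).finite
  exact Module.finite_of_finite K (M := AdjoinRoot h)

theorem Ideal.Quotient.eq_one_of_factor_eq_one {R : Type*} [CommRing R] {g k : R}
    (hgk : IsCoprime g k) (hg : Ideal.span {g * k} ≤ Ideal.span {g})
    (hk : Ideal.span {g * k} ≤ Ideal.span {k}) {u : R ⧸ Ideal.span {g * k}}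
    (hug : Ideal.Quotient.factor hg u = 1) (huk : Ideal.Quotient.factor hk u = 1) : u = 1 := by
  obtain ⟨f, rfl⟩ := Ideal.Quotient.mk_surjective u
  rw [Ideal.Quotient.factor_mk, ← map_one (Ideal.Quotient.mk _), Ideal.Quotient.eq,
    Ideal.mem_span_singleton] at hug huk
  rw [← map_one (Ideal.Quotient.mk _), Ideal.Quotient.eq, Ideal.mem_span_singleton]
  exact hgk.mul_dvd hug huk

/-- If `g` is prime, `g` and `k` are coprime and the prime `p` does not divide the order of
`(R/(k))ˣ`, then the `p`-torsion of `(R/(gk))ˣ` is generated by any of its nontrivial elements. -/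
theorem Ideal.Quotient.exists_pow_eq_of_pow_prime_eq_one {R : Type*} [CommRing R] {g k : R}
    (hg : Prime g) (hgk : IsCoprime g k) {p : ℕ} (hp : p.Prime)
    (hpk : ¬ p ∣ Nat.card (R ⧸ Ideal.span {k})ˣ) {x y : (R ⧸ Ideal.span {g * k})ˣ}
    (hx : x ^ p = 1) (hx1 : x ≠ 1) (hy : y ^ p = 1) : ∃ j : ℕ, x ^ j = y := by
  have hleg : Ideal.span {g * k} ≤ Ideal.span {g} :=
    Ideal.span_singleton_le_span_singleton.2 (dvd_mul_right g k)
  have hlek : Ideal.span {g * k} ≤ Ideal.span {k} :=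
    Ideal.span_singleton_le_span_singleton.2 (dvd_mul_left k g)
  have : (Ideal.span {g}).IsPrime := (Ideal.span_singleton_prime hg.ne_zero).2 hg
  have : Fact p.Prime := ⟨hp⟩
  set φ := Units.map (Ideal.Quotient.factor hleg).toMonoidHom
  set ψ := Units.map (Ideal.Quotient.factor hlek).toMonoidHom
  have key : ∀ u : (R ⧸ Ideal.span {g * k})ˣ, u ^ p = 1 → φ u = 1 → u = 1 := by
    intro u hu hu1
    have hψu : ψ u = 1 := by
      rw [← orderOf_eq_one_iff]
      refine Nat.eq_one_of_dvd_coprimes ((Nat.Prime.coprime_iff_not_dvd hp).2 hpk)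
        (orderOf_dvd_of_pow_eq_one ?_) (orderOf_dvd_natCard _)
      rw [← map_pow, hu, map_one]
    exact Units.ext (Ideal.Quotient.eq_one_of_factor_eq_one hgk hleg hlek
      (congrArg Units.val hu1) (congrArg Units.val hψu))
  have hprim : IsPrimitiveRoot (φ x) p := by
    have hord : orderOf (φ x) = p :=
      orderOf_eq_prime (by rw [← map_pow, hx, map_one]) fun h1 => hx1 (key x hx h1)
    rw [← hord]
    exact IsPrimitiveRoot.orderOf _
  have : NeZero p := ⟨hp.ne_zero⟩
  obtain ⟨j, -, hj⟩ := (IsPrimitiveRoot.coe_units_iff.2 hprim).eq_pow_of_pow_eq_one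
    (ξ := (φ y : R ⧸ Ideal.span {g})) (by rw [← Units.val_pow_eq_pow_val, ← map_pow, hy]; simp)
  refine ⟨j, ?_⟩
  rw [← mul_inv_eq_one]
  apply key
  · rw [mul_pow, inv_pow, hy, pow_right_comm, hx, one_pow, inv_one, mul_one]
  · rw [map_mul, map_pow, map_inv, mul_inv_eq_one]
    exact Units.ext (by rw [Units.val_pow_eq_pow_val, hj])

/-- Let `K` be a finite field of order `Q` and `h = g * k` in `K[x]`, with `g` irreducible of
degree `m` and `g ∤ k`.  Let `B > 0` be such that `gcd(|(K[x]/(k))ˣ|, Q^m - 1)` is `B`-smooth.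
Let `D` be a finite set of polynomials, each coprime to `h`, whose reductions modulo `g`
generate `(K[x]/(g))ˣ`, and let `G ≤ (K[x]/(h))ˣ` be generated by the reductions of the
elements of `D` modulo `h`.  If `G` is the internal direct sum of cyclic subgroups generated
by `e 0, …, e (n-1)` with orders `d 0 ∣ d 1 ∣ … ∣ d (n-1)`, then `gcd(d (n-2), Q^m - 1)` is
`B`-smooth. -/
theorem stmt1 {K : Type*} [Field K] [Fintype K] (Q : ℕ) (hQ : Fintype.card K = Q)
    (g k h : Polynomial K) (hh : h = g * k) (hg : Irreducible g) (m : ℕ)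
    (hm : g.natDegree = m) (hgk : ¬ g ∣ k)
    (B : ℕ) (hB : 0 < B)
    (hBsm : IsSmooth B
      (Nat.gcd (Nat.card (Polynomial K ⧸ Ideal.span {k})ˣ) (Q ^ m - 1)))
    (D : Finset (Polynomial K)) (hD : ∀ f ∈ D, IsCoprime f h)
    (hgen : Subgroup.closure {u : (Polynomial K ⧸ Ideal.span {g})ˣ |
        ∃ f ∈ D, (u : Polynomial K ⧸ Ideal.span {g}) = Ideal.Quotient.mk _ f} = ⊤)
    (G : Subgroup (Polynomial K ⧸ Ideal.span {h})ˣ)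
    (hG : G = Subgroup.closure {u : (Polynomial K ⧸ Ideal.span {h})ˣ |
        ∃ f ∈ D, (u : Polynomial K ⧸ Ideal.span {h}) = Ideal.Quotient.mk _ f})
    (n : ℕ) (hn : 2 ≤ n) (e : Fin n → G) (d : Fin n → ℕ)
    (hd : ∀ i, d i = orderOf (e i))
    (hdiv : ∀ (i : ℕ) (hi : i + 1 < n), d ⟨i, by omega⟩ ∣ d ⟨i + 1, hi⟩)
    (hgensum : ∀ x : G, ∃ c : Fin n → ℤ, x = ∏ i, e i ^ c i)
    (huniq : ∀ c c' : Fin n → ℤ, ∏ i, e i ^ c i = ∏ i, e i ^ c' i →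
      ∀ i, (d i : ℤ) ∣ c i - c' i) :
    IsSmooth B (Nat.gcd (d ⟨n - 2, by omega⟩) (Q ^ m - 1)) := by
  intro p hp hpd
  by_contra hpB
  have hpd2 := hpd.trans (Nat.gcd_dvd_left _ _)
  have hpQ := hpd.trans (Nat.gcd_dvd_right _ _)
  have hpk : ¬ p ∣ Nat.card (Polynomial K ⧸ Ideal.span {k})ˣ := fun hdvd =>
    hpB (hBsm p hp (Nat.dvd_gcd hdvd hpQ))
  have hk0 : k ≠ 0 := by
    rintro rfl
    exact hgk (dvd_zero g)
  subst hh
  have := Polynomial.finite_quotient_span_singleton (mul_ne_zero hg.ne_zero hk0)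
  set a : Fin n := ⟨n - 2, by omega⟩ with ha
  set b : Fin n := ⟨n - 1, by omega⟩ with hb
  have hab : a ≠ b := by
    simp only [ha, hb, ne_eq, Fin.mk.injEq]
    omega
  have hdab : d a ∣ d b := by
    have hstep := hdiv (n - 2) (by omega)
    have hb' : (⟨n - 2 + 1, by omega⟩ : Fin n) = b := Fin.ext (by simp only [hb]; omega)
    rwa [hb'] at hstep
  have horder : ∀ i, p ∣ d i → orderOf (e i ^ (d i / p)) = p := by
    intro i hi
    rw [hd] at hi ⊢
    exact orderOf_pow_orderOf_div (orderOf_pos (e i)).ne' hi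
  have hpow : ∀ i, p ∣ d i →
      ((e i ^ (d i / p) : G) : (Polynomial K ⧸ Ideal.span {g * k})ˣ) ^ p = 1 := by
    intro i hi
    rw [← Subgroup.coe_pow, orderOf_dvd_iff_pow_eq_one.1 (horder i hi).dvd, Subgroup.coe_one]
  obtain ⟨j, hj⟩ := Ideal.Quotient.exists_pow_eq_of_pow_prime_eq_one hg.prime
    ((hg.coprime_iff_not_dvd).2 hgk) hp hpk (hpow a hpd2)
    (by
      intro h1
      have h2 := horder a hpd2
      rw [OneMemClass.coe_eq_one.1 h1, orderOf_one] at h2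
      exact hp.one_lt.ne h2)
    (hpow b (hpd2.trans hdab))
  have hj' : (e a ^ (d a / p)) ^ j = e b ^ (d b / p) := Subtype.ext hj
  have hsingle : ∀ (i : Fin n) (t : ℤ), ∏ l, e l ^ (Pi.single i t : Fin n → ℤ) l = e i ^ t := by
    intro i t
    rw [Finset.prod_eq_single i (fun l _ hl => by simp [hl]) (by simp), Pi.single_eq_same]
  have hdvd := huniq (Pi.single b ((d b / p : ℕ) : ℤ)) (Pi.single a ((d a / p * j : ℕ) : ℤ))
    (by rw [hsingle, hsingle, zpow_natCast, zpow_natCast, pow_mul, hj']) b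
  rw [Pi.single_eq_same, Pi.single_eq_of_ne hab.symm, sub_zero, Int.natCast_dvd_natCast] at hdvd
  have hdb : 0 < d b := hd b ▸ orderOf_pos (e b)
  exact absurd (Nat.le_of_dvd (Nat.div_pos (Nat.le_of_dvd hdb (hpd2.trans hdab)) hp.pos) hdvd)
    (not_le.2 (Nat.div_lt_self hdb hp.one_lt))
end

section
/- Let K be a finite field of order Q and h = g·k in K[x], where g is irreducible of degree m and coprime to k. Let L be a positive divisor of Q^m − 1 such that gcd(L, |(K[x]/(k))ˣ|) = 1. Then the L-torsion subgroup {u ∈ (K[x]/(h))ˣ : u^L = 1} of the unit group (K[x]/(h))ˣ is cyclic of order L. -/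
/-- In a group `A ≃* B × C` with `B` finite cyclic, `L ∣ |B|` and `L` coprime to `|C|`, the
`L`-torsion subgroup is cyclic of order `L`. -/
theorem isCyclic_and_card_torsion_of_mulEquiv_prod {A B C : Type*} [Group A] [CommGroup B]
    [Group C] [Finite B] [IsCyclic B] (e : A ≃* B × C) {L : ℕ} (hdvd : L ∣ Nat.card B)
    (hcop : L.Coprime (Nat.card C)) (T : Subgroup A) (hT : ∀ u, u ∈ T ↔ u ^ L = 1) :
    IsCyclic T ∧ Nat.card T = L := by
  let f : T →* B := ((MonoidHom.fst B C).comp e.toMonoidHom).comp T.subtype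
  have hsnd : ∀ u ∈ T, (e u).2 = 1 := fun u hu ↦ by
    have hpow : (e u).2 ^ L = 1 := by
      rw [← Prod.pow_snd, ← map_pow, (hT u).1 hu, map_one, Prod.snd_one]
    exact orderOf_eq_one_iff.1 <| Nat.eq_one_of_dvd_coprimes hcop
      (orderOf_dvd_of_pow_eq_one hpow) (orderOf_dvd_natCard _)
  have hf : Function.Injective f := fun u v huv ↦
    Subtype.ext <| e.injective <| Prod.ext huv <| by rw [hsnd u u.2, hsnd v v.2]
  have hrange : f.range = (powMonoidHom L : B →* B).ker := by
    ext b
    rw [MonoidHom.mem_range, MonoidHom.mem_ker, powMonoidHom_apply]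
    constructor
    · rintro ⟨u, rfl⟩
      rw [← map_pow, show u ^ L = 1 from Subtype.ext ((hT u).1 u.2), map_one]
    · intro hb
      refine ⟨⟨e.symm (b, 1), (hT _).2 ?_⟩, ?_⟩
      · rw [← map_pow, Prod.pow_mk, hb, one_pow, Prod.mk_one_one, map_one]
      · simp [f]
  refine ⟨isCyclic_of_injective f hf, ?_⟩
  rw [Nat.card_congr (MonoidHom.ofInjective hf).toEquiv, hrange, IsCyclic.card_powMonoidHom_ker,
    Nat.gcd_eq_right hdvd]


/-- Let `K` be a finite field of order `Q` and `h = g * k` in `K[x]`, with `g` irreducible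
of degree `m` and coprime to `k`.  Let `L > 0` divide `Q^m - 1` with
`gcd(L, |(K[x]/(k))ˣ|) = 1`.  Then the `L`-torsion subgroup `{u : u^L = 1}` of
`(K[x]/(h))ˣ` is cyclic of order `L`. -/
theorem stmt8 {K : Type*} [Field K] [Fintype K] (Q : ℕ) (hQ : Fintype.card K = Q)
    (g k h : Polynomial K) (hh : h = g * k) (hg : Irreducible g) (m : ℕ)
    (hm : g.natDegree = m) (hcop : IsCoprime g k)
    (L : ℕ) (hL : 0 < L) (hLdvd : L ∣ Q ^ m - 1)
    (hgcd : Nat.gcd L (Nat.card (Polynomial K ⧸ Ideal.span {k})ˣ) = 1)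
    (T : Subgroup (Polynomial K ⧸ Ideal.span {h})ˣ)
    (hT : ∀ u : (Polynomial K ⧸ Ideal.span {h})ˣ, u ∈ T ↔ u ^ L = 1) :
    IsCyclic T ∧ Nat.card T = L := by
  subst hh hm hQ
  have : Fact (Irreducible g) := ⟨hg⟩
  have : (Ideal.span {g}).IsMaximal := PrincipalIdealRing.isMaximal_of_irreducible hg
  let : Field (Polynomial K ⧸ Ideal.span {g}) := Ideal.Quotient.field _
  have : Module.Finite K (Polynomial K ⧸ Ideal.span {g}) :=
    (AdjoinRoot.powerBasis hg.ne_zero).finite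
  have : Finite (Polynomial K ⧸ Ideal.span {g}) := Module.finite_of_finite K
  have hcard : Nat.card (Polynomial K ⧸ Ideal.span {g})ˣ = Fintype.card K ^ g.natDegree - 1 := by
    rw [Nat.card_units, Module.natCard_eq_pow_finrank (K := K),
      finrank_quotient_span_eq_natDegree, Nat.card_eq_fintype_card]
  let e : Polynomial K ⧸ Ideal.span {g * k} ≃+*
      (Polynomial K ⧸ Ideal.span {g}) × (Polynomial K ⧸ Ideal.span {k}) :=
    (Ideal.quotEquivOfEq (Ideal.span_singleton_mul_span_singleton g k).symm).trans
      (Ideal.quotientMulEquivQuotientProd _ _ ((Ideal.isCoprime_span_singleton_iff g k).2 hcop))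
  exact isCyclic_and_card_torsion_of_mulEquiv_prod
    ((Units.mapEquiv e.toMulEquiv).trans MulEquiv.prodUnits) (hcard ▸ hLdvd) hgcd T hT
end

section
/- Let q be a prime power, let F be a finite field with q elements, and let K be a field containing F as a subfield. Then for all a, b, c, d ∈ K, the following identity holds in the polynomial ring K[X]: (cX + d) · ∏_{α ∈ F} ((a − αc)X + (b − αd)) = (cX + d)(aX + b)^q − (aX + b)(cX + d)^q. -/
open Polynomial

theorem FiniteField.prod_X_sub_C_eq_X_pow_card_sub_X (F : Type*) [Field F] [Fintype F] :
    ∏ α : F, (X - C α) = (X ^ Fintype.card F - X : F[X]) := by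
  have hcard := Fintype.one_lt_card (α := F)
  have hroots := FiniteField.roots_X_pow_card_sub_X F
  have hmonic : (X ^ Fintype.card F - X : F[X]).Monic :=
    monic_X_pow_sub (by simpa using hcard)
  have h := prod_multiset_X_sub_C_of_monic_of_roots_card_eq hmonic (by
    rw [hroots, FiniteField.X_pow_card_sub_X_natDegree_eq F hcard]
    rfl)
  rwa [hroots] at h

theorem FiniteField.prod_sub_algebraMap_eq {F A : Type*} [Field F] [Fintype F] [CommRing A]
    [Algebra F A] (y : A) :
    ∏ α : F, (y - algebraMap F A α) = y ^ Fintype.card F - y := by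
  simpa [map_prod] using
    congrArg (aeval y) (FiniteField.prod_X_sub_C_eq_X_pow_card_sub_X F)

/-- The homogeneous form of `∏ α, (Y - α) = Y ^ q - Y`. -/
theorem FiniteField.mul_prod_sub_algebraMap_mul_eq {F A : Type*} [Field F] [Fintype F]
    [CommRing A] [IsDomain A] [Algebra F A] (u v : A) :
    v * ∏ α : F, (u - algebraMap F A α * v) =
      v * u ^ Fintype.card F - u * v ^ Fintype.card F := by
  rcases eq_or_ne v 0 with rfl | hv
  · simp
  apply IsFractionRing.injective A (FractionRing A)
  have hv' : algebraMap A (FractionRing A) v ≠ 0 := by simpa using hv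
  simp only [map_mul, map_prod, map_sub, map_pow, ← IsScalarTower.algebraMap_apply]
  generalize algebraMap A (FractionRing A) v = w at hv'
  generalize algebraMap A (FractionRing A) u = z
  have h (α : F) : z - algebraMap F (FractionRing A) α * w =
      w * (z / w - algebraMap F (FractionRing A) α) := by
    field_simp
  simp only [h, Finset.prod_mul_distrib, Finset.prod_const, Finset.card_univ,
    FiniteField.prod_sub_algebraMap_eq]
  rw [mul_sub, ← mul_pow, mul_div_cancel₀ z hv', mul_sub]
  field_simp

/-- Let `q` be a prime power, `F` a finite field with `q` elements sitting as a subfield of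
a field `K`.  Then for all `a b c d ∈ K` we have, in `K[X]`,
`(cX + d) · ∏_{α ∈ F} ((a - αc)X + (b - αd)) = (cX + d)(aX + b)^q - (aX + b)(cX + d)^q`. -/
theorem stmt9 {K : Type*} [Field K] (F : Subfield K) [Fintype F] (q : ℕ)
    (hq : Fintype.card F = q) (hq' : IsPrimePow q) (a b c d : K) :
    (C c * X + C d) *
        ∏ α : F, (C (a - (α : K) * c) * X + C (b - (α : K) * d)) =
      (C c * X + C d) * (C a * X + C b) ^ q -
        (C a * X + C b) * (C c * X + C d) ^ q := by
  subst hq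
  rw [← FiniteField.mul_prod_sub_algebraMap_mul_eq]
  congr 1
  refine Finset.prod_congr rfl fun α _ => ?_
  have hα : algebraMap F K[X] α = C (α : K) := rfl
  simp only [hα, C_sub, C_mul]
  ring
end

section
/- Let K be a finite field, m > 2 an integer, and r ≥ m an integer. Write r − m = s(m−1) + t with s, t nonnegative integers and t < m−1, and suppose t ≠ 1. For k ≥ 1 let I_k denote the number of monic irreducible polynomials of degree k in K[x], and set I_0 = 1. Then the number of monic polynomials f of degree r in K[x] such that (i) f has a monic irreducible factor of degree m, (ii) the square of that degree-m irreducible factor does not divide f, and (iii) f has no linear factor, is at least I_m · binom(I_{m−1}, s) · I_t. -/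
open Polynomial in
theorem Polynomial.finite_setOf_natDegree_eq {K : Type*} [Field K] [Finite K] (n : ℕ) :
    {f : K[X] | f.natDegree = n}.Finite := by
  refine Set.Finite.of_finite_image (f := fun f : K[X] => fun i : Fin (n + 1) => f.coeff i)
    (Set.toFinite _) ?_
  intro f hf g hg hfg
  ext i
  by_cases hi : i < n + 1
  · exact congrFun hfg ⟨i, hi⟩
  · rw [coeff_eq_zero_of_natDegree_lt, coeff_eq_zero_of_natDegree_lt] <;>
      simp only [Set.mem_ofPred_eq] at hf hg <;> omega

open Polynomial in
theorem Polynomial.Monic.eq_of_irreducible_of_dvd {K : Type*} [Field K] {p q : K[X]}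
    (hp : p.Monic) (hq : q.Monic) (hpi : Irreducible p) (hqi : Irreducible q) (h : p ∣ q) :
    p = q :=
  eq_of_monic_of_associated hp hq (hpi.associated_of_dvd hqi h)

open Polynomial in
theorem Polynomial.Monic.mem_or_eq_of_dvd_prod_mul {K : Type*} [Field K] {q u : K[X]}
    {S : Finset K[X]} (hq : q.Monic) (hqi : Irreducible q)
    (hS : ∀ x ∈ S, x.Monic ∧ Irreducible x) (hu : u.Monic) (hui : u = 1 ∨ Irreducible u)
    (h : q ∣ (∏ x ∈ S, x) * u) : q ∈ S ∨ q = u := by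
  rcases hqi.prime.dvd_or_dvd h with h | h
  · obtain ⟨x, hx, hqx⟩ := (hqi.prime.dvd_finsetProd_iff _).1 h
    rw [hq.eq_of_irreducible_of_dvd (hS x hx).1 hqi (hS x hx).2 hqx]
    exact Or.inl hx
  · rcases hui with rfl | hui
    · exact absurd (isUnit_of_dvd_one h) hqi.not_isUnit
    · exact Or.inr (hq.eq_of_irreducible_of_dvd hu hqi hui h)

open Polynomial in
theorem Polynomial.Monic.eq_or_mem_or_eq_of_dvd_mul_prod_mul {K : Type*} [Field K]
    {p q u : K[X]} {S : Finset K[X]} (hq : q.Monic) (hqi : Irreducible q)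
    (hp : p.Monic) (hpi : Irreducible p)
    (hS : ∀ x ∈ S, x.Monic ∧ Irreducible x) (hu : u.Monic) (hui : u = 1 ∨ Irreducible u)
    (h : q ∣ p * ((∏ x ∈ S, x) * u)) : q = p ∨ q ∈ S ∨ q = u := by
  rcases hqi.prime.dvd_or_dvd h with h | h
  · exact Or.inl (hq.eq_of_irreducible_of_dvd hp hqi hpi h)
  · exact Or.inr (hq.mem_or_eq_of_dvd_prod_mul hqi hS hu hui h)

/-- Let `K` be a finite field, `m > 2`, `r ≥ m`, and write `r - m = s(m-1) + t` with
`t < m - 1` and `t ≠ 1`.  Let `I k` be the number of monic irreducible polynomials of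
degree `k` in `K[x]` for `k ≥ 1`, with `I 0 = 1`.  Then the number of monic polynomials `f`
of degree `r` having a monic irreducible factor of degree `m` whose square does not divide
`f`, and having no linear factor, is at least `I m * choose (I (m-1)) s * I t`. -/
theorem stmt11 {K : Type*} [Field K] [Fintype K] (m r s t : ℕ) (hm : 2 < m) (hrm : m ≤ r)
    (hst : r - m = s * (m - 1) + t) (ht : t < m - 1) (ht1 : t ≠ 1)
    (I : ℕ → ℕ)
    (hI : ∀ k, 1 ≤ k →
      I k = Nat.card {f : Polynomial K // f.Monic ∧ Irreducible f ∧ f.natDegree = k})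
    (hI0 : I 0 = 1) :
    I m * Nat.choose (I (m - 1)) s * I t ≤
      Nat.card {f : Polynomial K // f.Monic ∧ f.natDegree = r ∧
        (∃ π : Polynomial K, π.Monic ∧ Irreducible π ∧ π.natDegree = m ∧
          π ∣ f ∧ ¬ π ^ 2 ∣ f) ∧
        ¬ ∃ l : Polynomial K, l.natDegree = 1 ∧ l ∣ f} := by
  classical
  have fin (P : Polynomial K → Prop) (n : ℕ) (hP : ∀ f, P f → f.natDegree = n) :
      {f | P f}.Finite := (Polynomial.finite_setOf_natDegree_eq n).subset hP
  let A (k : ℕ) : Finset (Polynomial K) :=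
    (fin (fun f => f.Monic ∧ Irreducible f ∧ f.natDegree = k) k fun _ h => h.2.2).toFinset
  let T : Finset (Polynomial K) := if t = 0 then {1} else A t
  have mem_A (k : ℕ) (f : Polynomial K) :
      f ∈ A k ↔ f.Monic ∧ Irreducible f ∧ f.natDegree = k := by simp [A]
  have card_A (k : ℕ) (hk : 1 ≤ k) : I k = (A k).card := by
    rw [hI k hk]
    exact Nat.card_eq_card_finite_toFinset _
  have card_T : I t = T.card := by
    by_cases h0 : t = 0
    · simp [T, h0, hI0]
    · simp only [T, if_neg h0]
      exact card_A t (by omega)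
  have mem_T (u : Polynomial K) (h : u ∈ T) :
      u.Monic ∧ (u = 1 ∨ Irreducible u) ∧ u.natDegree = t := by
    by_cases h0 : t = 0
    · obtain rfl : u = 1 := by simpa [T, h0] using h
      simp [h0]
    · simp only [T, if_neg h0, mem_A] at h
      exact ⟨h.1, Or.inr h.2.1, h.2.2⟩
  have mem_S (S : Finset (Polynomial K)) (h : S ∈ (A (m - 1)).powersetCard s) :
      (∀ x ∈ S, x.Monic ∧ Irreducible x) ∧ (∀ x ∈ S, x.natDegree = m - 1) ∧ S.card = s := by
    rw [Finset.mem_powersetCard] at h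
    have h' x (hx : x ∈ S) := (mem_A _ _).1 (h.1 hx)
    exact ⟨fun x hx => ⟨(h' x hx).1, (h' x hx).2.1⟩, fun x hx => (h' x hx).2.2, h.2⟩
  rw [card_A m (by omega), card_A (m - 1) (by omega), card_T, ← Finset.card_powersetCard,
    mul_assoc, ← Finset.card_product, ← Finset.card_product]
  refine le_of_le_of_eq (Finset.card_le_card_of_injOn
    (t := (fin _ r fun f h => h.2.1).toFinset)
    (fun a => a.1 * ((∏ x ∈ a.2.1, x) * a.2.2)) ?_ ?_) (Nat.card_eq_card_finite_toFinset _).symm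
  · rintro ⟨p, S, u⟩ h
    simp only [Finset.coe_product, Set.mem_prod, Finset.mem_coe] at h
    obtain ⟨hp, hpi, hpd⟩ := (mem_A _ _).1 h.1
    obtain ⟨hS, hSd, hSc⟩ := mem_S S h.2.1
    obtain ⟨hu, hui, hud⟩ := mem_T u h.2.2
    have hSm : (∏ x ∈ S, x).Monic := Polynomial.monic_prod_of_monic _ _ fun x hx => (hS x hx).1
    simp only [Set.Finite.coe_toFinset, Set.mem_ofPred_eq]
    refine ⟨hp.mul (hSm.mul hu), ?_, ⟨p, hp, hpi, hpd, dvd_mul_right _ _, ?_⟩, ?_⟩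
    · rw [hp.natDegree_mul (hSm.mul hu), hSm.natDegree_mul hu,
        Polynomial.natDegree_prod_of_monic _ _ fun x hx => (hS x hx).1,
        Finset.sum_congr rfl hSd, Finset.sum_const, hSc, smul_eq_mul]
      omega
    · rw [sq, mul_dvd_mul_iff_left hp.ne_zero]
      intro hd
      rcases hp.mem_or_eq_of_dvd_prod_mul hpi hS hu hui hd with hd | rfl
      · have := hSd p hd
        omega
      · omega
    · rintro ⟨l, hl, hlf⟩
      have hl0 : l ≠ 0 := by
        rintro rfl
        simp at hl
      have hli : Irreducible l :=
        Polynomial.irreducible_of_degree_eq_one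
          ((Polynomial.degree_eq_iff_natDegree_eq_of_pos one_pos).2 hl)
      have hass := normalize_associated l
      have hnd : (normalize l).natDegree = 1 := by
        rw [Polynomial.natDegree_eq_of_degree_eq Polynomial.degree_normalize, hl]
      rcases (Polynomial.monic_normalize hl0).eq_or_mem_or_eq_of_dvd_mul_prod_mul
        (hass.symm.irreducible hli) hp hpi hS hu hui (hass.dvd.trans hlf) with h | h | h
      · rw [h] at hnd
        omega
      · have := hSd _ h
        omega
      · rw [h] at hnd
        omega
  · rintro ⟨p, S, u⟩ h ⟨p', S', u'⟩ h' heq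
    simp only [Finset.coe_product, Set.mem_prod, Finset.mem_coe] at h h'
    obtain ⟨hp, hpi, hpd⟩ := (mem_A _ _).1 h.1
    obtain ⟨hS, hSd, hSc⟩ := mem_S S h.2.1
    obtain ⟨hu, hui, hud⟩ := mem_T u h.2.2
    obtain ⟨hp', hpi', hpd'⟩ := (mem_A _ _).1 h'.1
    obtain ⟨hS', hSd', hSc'⟩ := mem_S S' h'.2.1
    obtain ⟨hu', hui', hud'⟩ := mem_T u' h'.2.2
    have hSm : (∏ x ∈ S, x).Monic := Polynomial.monic_prod_of_monic _ _ fun x hx => (hS x hx).1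
    dsimp only at heq
    have hpp : p = p' := by
      rcases hp.eq_or_mem_or_eq_of_dvd_mul_prod_mul hpi hp' hpi' hS' hu' hui'
        (heq ▸ dvd_mul_right _ _) with h | h | h
      · exact h
      · have := hSd' _ h
        omega
      · rw [h] at hpd
        omega
    subst hpp
    have heq' := mul_left_cancel₀ hp.ne_zero heq
    have hSS : S = S' := by
      refine Finset.eq_of_subset_of_card_le (fun x hx => ?_) (by omega)
      have hxd := hSd x hx
      rcases (hS x hx).1.mem_or_eq_of_dvd_prod_mul (hS x hx).2 hS' hu' hui'
        (heq' ▸ (Finset.dvd_prod_of_mem _ hx).mul_right _) with h | h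
      · exact h
      · rw [h] at hxd
        omega
    subst hSS
    rw [mul_left_cancel₀ hSm.ne_zero heq']
end
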